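/- arXiv:1809.03550 — 5 statements merged into one kernel-verified Lean document; each statement's English description precedes it below -/
import Mathlib

section
/- For every fixed matrix R : Matrix (Fin r) (Fin n) ℝ, the function L ↦ f(L, R) is convex on Matrix (Fin m) (Fin r) ℝ, and for every fixed L : Matrix (Fin m) (Fin r) ℝ, the function R ↦ f(L, R) is convex on Matrix (Fin r) (Fin n) ℝ (marginal convexity of the inequality-constrained matrix-completion objective). -/
/-- The inequality-constrained matrix-completion objective
`f(L, R) = (1/2) Σ (max (l i j - (L*R) i j) 0)^2 + (1/2) Σ (max ((L*R) i j - u i j) 0)^2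
  + (ν/2) ‖L‖_F^2 + (ν/2) ‖R‖_F^2`,
with the Frobenius norms written out as sums of squares of entries. -/
noncomputable def objf (m n r : ℕ) (ν : ℝ) (l u : Matrix (Fin m) (Fin n) ℝ)
    (L : Matrix (Fin m) (Fin r) ℝ) (R : Matrix (Fin r) (Fin n) ℝ) : ℝ :=
  (1 / 2) * ∑ i, ∑ j, (max (l i j - (L * R) i j) 0) ^ 2
    + (1 / 2) * ∑ i, ∑ j, (max ((L * R) i j - u i j) 0) ^ 2
    + (ν / 2) * ∑ i, ∑ k, (L i k) ^ 2
    + (ν / 2) * ∑ k, ∑ j, (R k j) ^ 2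

theorem mc_aux_sum {E ι : Type*} [AddCommGroup E] [Module ℝ E] [Fintype ι] (g : ι → E → ℝ)
    (h : ∀ i, ConvexOn ℝ Set.univ (g i)) : ConvexOn ℝ Set.univ (fun x => ∑ i, g i x) := by
  refine ⟨convex_univ, fun x _ y _ a b ha hb hab => ?_⟩
  simp only [smul_eq_mul, Finset.mul_sum, ← Finset.sum_add_distrib]
  exact Finset.sum_le_sum fun i _ => (h i).2 (Set.mem_univ x) (Set.mem_univ y) ha hb hab

theorem mc_aux_mul {E : Type*} [AddCommGroup E] [Module ℝ E] (c : ℝ) (hc : 0 ≤ c) (g : E → ℝ)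
    (h : ConvexOn ℝ Set.univ g) : ConvexOn ℝ Set.univ (fun x => c * g x) :=
  h.smul hc

theorem mc_aux_sq {E : Type*} [AddCommGroup E] [Module ℝ E] (g : E →ₗ[ℝ] ℝ) :
    ConvexOn ℝ Set.univ (fun x => (g x) ^ 2) :=
  (even_two.convexOn_pow (𝕜 := ℝ)).comp_linearMap g

theorem mc_aux_hinge : ConvexOn ℝ Set.univ (fun x : ℝ => (max x 0) ^ 2) := by
  have h : ConvexOn ℝ Set.univ (fun x : ℝ => max x 0) :=
    (convexOn_id convex_univ).sup (convexOn_const 0 convex_univ)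
  exact h.pow (fun x _ => le_max_right _ _) 2

theorem mc_aux_lo {E : Type*} [AddCommGroup E] [Module ℝ E] (g : E →ₗ[ℝ] ℝ) (c : ℝ) :
    ConvexOn ℝ Set.univ (fun x => (max (c - g x) 0) ^ 2) := by
  refine ⟨convex_univ, fun x _ y _ a b ha hb hab => ?_⟩
  have := mc_aux_hinge.2 (Set.mem_univ (c - g x)) (Set.mem_univ (c - g y)) ha hb hab
  have e : c - g (a • x + b • y) = a • (c - g x) + b • (c - g y) := by
    simp only [map_add, map_smul, smul_eq_mul]
    linear_combination (-c) * hab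
  simpa only [e] using this

theorem mc_aux_hi {E : Type*} [AddCommGroup E] [Module ℝ E] (g : E →ₗ[ℝ] ℝ) (c : ℝ) :
    ConvexOn ℝ Set.univ (fun x => (max (g x - c) 0) ^ 2) := by
  have h := mc_aux_lo (-g) (-c)
  have e : ∀ x, -c - (-g) x = g x - c := fun x => by
    rw [LinearMap.neg_apply]; ring
  simpa only [e] using h

/-- Marginal convexity of the inequality-constrained matrix-completion objective:
for every fixed `R` the map `L ↦ f(L, R)` is convex, and for every fixed `L`
the map `R ↦ f(L, R)` is convex. -/
theorem marginal_convexity (m n r : ℕ) (hm : 0 < m) (hn : 0 < n) (hr : 0 < r)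
    (ν : ℝ) (hν : 0 < ν) (l u : Matrix (Fin m) (Fin n) ℝ)
    (hlu : ∀ i j, l i j ≤ u i j) :
    (∀ R : Matrix (Fin r) (Fin n) ℝ,
      ConvexOn ℝ Set.univ (fun L : Matrix (Fin m) (Fin r) ℝ => objf m n r ν l u L R)) ∧
    (∀ L : Matrix (Fin m) (Fin r) ℝ,
      ConvexOn ℝ Set.univ (fun R : Matrix (Fin r) (Fin n) ℝ => objf m n r ν l u L R)) := by
  have hν2 : 0 ≤ ν / 2 := by positivity
  have h2 : (0 : ℝ) ≤ 1 / 2 := by norm_num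
  refine ⟨fun R => ?_, fun L => ?_⟩
  · have e : ∀ i j, ∃ g : Matrix (Fin m) (Fin r) ℝ →ₗ[ℝ] ℝ, ∀ L, g L = (L * R) i j :=
      fun i j => ⟨{ toFun := fun L => (L * R) i j
                    map_add' := fun x y => by simp [Matrix.add_mul]
                    map_smul' := fun a x => by simp }, fun _ => rfl⟩
    choose g hg using e
    unfold objf
    simp only [← hg]
    refine (((mc_aux_mul _ h2 _ ?_).add (mc_aux_mul _ h2 _ ?_)).add
      (mc_aux_mul _ hν2 _ ?_)).add (convexOn_const _ convex_univ)
    · exact mc_aux_sum _ fun i => mc_aux_sum _ fun j => mc_aux_lo (g i j) _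
    · exact mc_aux_sum _ fun i => mc_aux_sum _ fun j => mc_aux_hi (g i j) _
    · exact mc_aux_sum _ fun i => mc_aux_sum _ fun j => mc_aux_sq (Matrix.entryLinearMap ℝ ℝ i j)
  · have e : ∀ i j, ∃ g : Matrix (Fin r) (Fin n) ℝ →ₗ[ℝ] ℝ, ∀ R, g R = (L * R) i j :=
      fun i j => ⟨{ toFun := fun R => (L * R) i j
                    map_add' := fun x y => by simp [Matrix.mul_add]
                    map_smul' := fun a x => by simp }, fun _ => rfl⟩
    choose g hg using e
    unfold objf
    simp only [← hg]
    refine (((mc_aux_mul _ h2 _ ?_).add (mc_aux_mul _ h2 _ ?_)).add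
      (convexOn_const _ convex_univ)).add (mc_aux_mul _ hν2 _ ?_)
    · exact mc_aux_sum _ fun i => mc_aux_sum _ fun j => mc_aux_lo (g i j) _
    · exact mc_aux_sum _ fun i => mc_aux_sum _ fun j => mc_aux_hi (g i j) _
    · exact mc_aux_sum _ fun i => mc_aux_sum _ fun j => mc_aux_sq (Matrix.entryLinearMap ℝ ℝ i j)
end

section
/- For every fixed matrix R : Matrix (Fin r) (Fin n) ℝ, the function L ↦ f(L, R) is ν-strongly convex with respect to the Frobenius norm (equivalently, L ↦ f(L, R) - (ν/2)·‖L‖_F^2 is convex), and symmetrically, for every fixed L, the function R ↦ f(L, R) is ν-strongly convex. -/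
/-- The data-fit part of the objective is convex along any linear map, up to constants. -/
theorem dataFit_convexOn {E : Type*} [AddCommMonoid E] [Module ℝ E] (m n : ℕ)
    (l u : Matrix (Fin m) (Fin n) ℝ) (c : ℝ) (g : E →ₗ[ℝ] Matrix (Fin m) (Fin n) ℝ) :
    ConvexOn ℝ Set.univ (fun x : E =>
      (1 / 2) * ∑ i, ∑ j, (max (l i j - (g x) i j) 0) ^ 2
        + (1 / 2) * ∑ i, ∑ j, (max ((g x) i j - u i j) 0) ^ 2 + c) := by
  have key : ∀ p q s a b : ℝ, 0 ≤ a → 0 ≤ b → a + b = 1 → s = a * p + b * q →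
      (max s 0) ^ 2 ≤ a * (max p 0) ^ 2 + b * (max q 0) ^ 2 := by
    intro p q s a b ha hb hab hs
    have h1 : max s 0 ≤ a * max p 0 + b * max q 0 := by
      apply max_le
      · rw [hs]
        gcongr
        · exact le_max_left _ _
        · exact le_max_left _ _
      · positivity
    have h2 : (max s 0) ^ 2 ≤ (a * max p 0 + b * max q 0) ^ 2 := by
      gcongr
    have hb' : b = 1 - a := by linarith
    subst hb'
    nlinarith [mul_nonneg (mul_nonneg ha hb) (sq_nonneg (max p 0 - max q 0))]
  refine ⟨convex_univ, ?_⟩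
  intro x _ y _ a b ha hb hab
  have hA : ∑ i, ∑ j, (max (l i j - (g (a • x + b • y)) i j) 0) ^ 2 ≤
      a * ∑ i, ∑ j, (max (l i j - (g x) i j) 0) ^ 2
        + b * ∑ i, ∑ j, (max (l i j - (g y) i j) 0) ^ 2 := by
    simp only [Finset.mul_sum, ← Finset.sum_add_distrib]
    refine Finset.sum_le_sum fun i _ => Finset.sum_le_sum fun j _ => ?_
    refine key _ _ _ a b ha hb hab ?_
    simp only [map_add, map_smul, Matrix.add_apply, Matrix.smul_apply, smul_eq_mul]
    linear_combination (-(l i j)) * hab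
  have hB : ∑ i, ∑ j, (max ((g (a • x + b • y)) i j - u i j) 0) ^ 2 ≤
      a * ∑ i, ∑ j, (max ((g x) i j - u i j) 0) ^ 2
        + b * ∑ i, ∑ j, (max ((g y) i j - u i j) 0) ^ 2 := by
    simp only [Finset.mul_sum, ← Finset.sum_add_distrib]
    refine Finset.sum_le_sum fun i _ => Finset.sum_le_sum fun j _ => ?_
    refine key _ _ _ a b ha hb hab ?_
    simp only [map_add, map_smul, Matrix.add_apply, Matrix.smul_apply, smul_eq_mul]
    linear_combination (u i j) * hab
  have hc : c = a * c + b * c := by rw [← add_mul, hab, one_mul]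
  simp only [smul_eq_mul]
  linarith

/-- Marginal strong convexity: for every fixed `R` the map `L ↦ f(L, R)` is ν-strongly
convex with respect to the Frobenius norm, i.e. `L ↦ f(L, R) - (ν/2)‖L‖_F²` is convex,
and symmetrically for every fixed `L` the map `R ↦ f(L, R)` is ν-strongly convex. -/
theorem marginal_strong_convexity (m n r : ℕ) (hm : 0 < m) (hn : 0 < n) (hr : 0 < r)
    (ν : ℝ) (hν : 0 < ν) (l u : Matrix (Fin m) (Fin n) ℝ)
    (hlu : ∀ i j, l i j ≤ u i j) :
    (∀ R : Matrix (Fin r) (Fin n) ℝ,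
      ConvexOn ℝ Set.univ (fun L : Matrix (Fin m) (Fin r) ℝ =>
        objf m n r ν l u L R - (ν / 2) * ∑ i, ∑ k, (L i k) ^ 2)) ∧
    (∀ L : Matrix (Fin m) (Fin r) ℝ,
      ConvexOn ℝ Set.univ (fun R : Matrix (Fin r) (Fin n) ℝ =>
        objf m n r ν l u L R - (ν / 2) * ∑ k, ∑ j, (R k j) ^ 2)) := by
  constructor
  · intro R
    let g : Matrix (Fin m) (Fin r) ℝ →ₗ[ℝ] Matrix (Fin m) (Fin n) ℝ :=
      { toFun := fun L => L * R
        map_add' := fun x y => Matrix.add_mul x y R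
        map_smul' := fun a x => Matrix.smul_mul a x R }
    refine ConvexOn.congr (dataFit_convexOn m n l u ((ν / 2) * ∑ k, ∑ j, (R k j) ^ 2) g) ?_
    intro L _
    simp only [objf, g, LinearMap.coe_mk, AddHom.coe_mk]
    ring
  · intro L
    let g : Matrix (Fin r) (Fin n) ℝ →ₗ[ℝ] Matrix (Fin m) (Fin n) ℝ :=
      { toFun := fun R => L * R
        map_add' := fun x y => Matrix.mul_add L x y
        map_smul' := fun a x => Matrix.mul_smul L a x }
    refine ConvexOn.congr (dataFit_convexOn m n l u ((ν / 2) * ∑ i, ∑ k, (L i k) ^ 2) g) ?_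
    intro R _
    simp only [objf, g, LinearMap.coe_mk, AddHom.coe_mk]
    ring
end

section
/- Let E and F be real inner product spaces and f : E × F → ℝ with marginal gradients defined everywhere. Suppose f is α-marginally strongly convex and β-marginally strongly smooth for some 0 < α ≤ β, that (x*, y*) is a global minimizer of f with f* = f(x*, y*) and ∇ₓ f(x*, y*) = 0, ∇_y f(x*, y*) = 0, and that C > 0 is such that f satisfies the C-robust bistability inequality. Then for every (x, y), every x̃ minimizing f(·, y) (with ∇ₓ f(x̃, y) = 0) and every ỹ minimizing f(x, ·) (with ∇_y f(x, ỹ) = 0): ‖x - x*‖² + ‖y - y*‖² ≤ (C·β/α)·(‖x - x̃‖² + ‖y - ỹ‖²). -/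
open scoped RealInnerProductSpace

/-- (Lemma 4.4 of Jain et al.) If `f : E × F → ℝ` is α-marginally strongly convex and
β-marginally strongly smooth with `0 < α ≤ β`, `(x*, y*)` is a global minimizer with
vanishing marginal gradients and value `f*`, and `f` satisfies the C-robust bistability
inequality with `C > 0`, then for every `(x, y)`, every marginal minimizer `x̃` of
`f(·, y)` (with vanishing marginal gradient) and every marginal minimizer `ỹ` of
`f(x, ·)` (with vanishing marginal gradient):
`‖x - x*‖² + ‖y - y*‖² ≤ (Cβ/α)(‖x - x̃‖² + ‖y - ỹ‖²)`. -/
theorem distance_to_optimum_bound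
    {E F : Type*} [NormedAddCommGroup E] [InnerProductSpace ℝ E]
    [NormedAddCommGroup F] [InnerProductSpace ℝ F]
    (f : E × F → ℝ) (gx : E × F → E) (gy : E × F → F)
    (α β : ℝ) (hα : 0 < α) (hαβ : α ≤ β)
    (hMSCx : ∀ (x x' : E) (y : F),
      f (x', y) ≥ f (x, y) + ⟪gx (x, y), x' - x⟫ + (α / 2) * ‖x' - x‖ ^ 2)
    (hMSCy : ∀ (x : E) (y y' : F),
      f (x, y') ≥ f (x, y) + ⟪gy (x, y), y' - y⟫ + (α / 2) * ‖y' - y‖ ^ 2)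
    (hMSSx : ∀ (x x' : E) (y : F),
      f (x', y) ≤ f (x, y) + ⟪gx (x, y), x' - x⟫ + (β / 2) * ‖x' - x‖ ^ 2)
    (hMSSy : ∀ (x : E) (y y' : F),
      f (x, y') ≤ f (x, y) + ⟪gy (x, y), y' - y⟫ + (β / 2) * ‖y' - y‖ ^ 2)
    (xs : E) (ys : F) (hmin : ∀ p : E × F, f (xs, ys) ≤ f p)
    (fs : ℝ) (hfs : fs = f (xs, ys))
    (hgxs : gx (xs, ys) = 0) (hgys : gy (xs, ys) = 0)
    (C : ℝ) (hC : 0 < C)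
    (hbistab : ∀ (x : E) (y : F) (xt : E) (yt : F),
      (∀ x' : E, f (xt, y) ≤ f (x', y)) → (∀ y' : F, f (x, yt) ≤ f (x, y')) →
      f (x, ys) + f (xs, y) - 2 * fs ≤ C * (2 * f (x, y) - f (x, yt) - f (xt, y))) :
    ∀ (x : E) (y : F) (xt : E) (yt : F),
      (∀ x' : E, f (xt, y) ≤ f (x', y)) → gx (xt, y) = 0 →
      (∀ y' : F, f (x, yt) ≤ f (x, y')) → gy (x, yt) = 0 →
      ‖x - xs‖ ^ 2 + ‖y - ys‖ ^ 2 ≤ (C * β / α) * (‖x - xt‖ ^ 2 + ‖y - yt‖ ^ 2) := by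
  intro x y xt yt hx hgx hy hgy
  have h1 := hMSCx xs x ys
  have h2 := hMSCy xs ys y
  have h3 := hMSSx xt x y
  have h4 := hMSSy x yt y
  have h5 := hbistab x y xt yt hx hy
  rw [hgxs, inner_zero_left] at h1
  rw [hgys, inner_zero_left] at h2
  rw [hgx, inner_zero_left] at h3
  rw [hgy, inner_zero_left] at h4
  have h6 : C * (2 * f (x, y) - f (x, yt) - f (xt, y)) ≤
      C * (β / 2 * (‖x - xt‖ ^ 2 + ‖y - yt‖ ^ 2)) :=
    mul_le_mul_of_nonneg_left (by linarith) hC.le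
  rw [div_mul_eq_mul_div, le_div_iff₀ hα]
  linarith
end

section
/- (Per-step contraction of alternating minimization, Theorem 1, one step.) Let E and F be real inner product spaces and f : E × F → ℝ with marginal gradients defined everywhere. Suppose f is α-marginally strongly convex and β-marginally strongly smooth with 0 < α ≤ β, that (x*, y*) is a global minimizer of f with f* = f(x*, y*) and vanishing marginal gradients at (x*, y*), and that C > 0 is such that f satisfies the C-robust bistability inequality. Suppose every marginal minimizer has vanishing corresponding marginal gradient. Let sequences (x_k), (y_k) satisfy, for each k: x_{k+1} minimizes f(·, y_k) and y_{k+1} minimizes f(x_{k+1}, ·). Set κ = β/α and η₀ = 2κ(1 + Cκ)/(1 + 2κ(1 + Cκ)). Then for every k: f(x_{k+1}, y_{k+1}) - f* ≤ η₀ · (f(x_k, y_k) - f*). -/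
open scoped RealInnerProductSpace

/-- Per-step contraction of alternating minimization (one step of Theorem 1):
under α-marginal strong convexity, β-marginal strong smoothness (`0 < α ≤ β`),
a global minimizer `(x*, y*)` with vanishing marginal gradients and value `f*`,
C-robust bistability (`C > 0`), vanishing marginal gradients at all marginal
minimizers, and alternating iterates `x_{k+1} ∈ argmin f(·, y_k)`,
`y_{k+1} ∈ argmin f(x_{k+1}, ·)`, one has, with `κ = β/α` and
`η₀ = 2κ(1 + Cκ)/(1 + 2κ(1 + Cκ))`:
`f(x_{k+1}, y_{k+1}) - f* ≤ η₀ (f(x_k, y_k) - f*)` for every `k`. -/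
theorem alternating_minimization_per_step_contraction
    {E F : Type*} [NormedAddCommGroup E] [InnerProductSpace ℝ E]
    [NormedAddCommGroup F] [InnerProductSpace ℝ F]
    (f : E × F → ℝ) (gx : E × F → E) (gy : E × F → F)
    (α β : ℝ) (hα : 0 < α) (hαβ : α ≤ β)
    (hMSCx : ∀ (x x' : E) (y : F),
      f (x', y) ≥ f (x, y) + ⟪gx (x, y), x' - x⟫ + (α / 2) * ‖x' - x‖ ^ 2)
    (hMSCy : ∀ (x : E) (y y' : F),
      f (x, y') ≥ f (x, y) + ⟪gy (x, y), y' - y⟫ + (α / 2) * ‖y' - y‖ ^ 2)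
    (hMSSx : ∀ (x x' : E) (y : F),
      f (x', y) ≤ f (x, y) + ⟪gx (x, y), x' - x⟫ + (β / 2) * ‖x' - x‖ ^ 2)
    (hMSSy : ∀ (x : E) (y y' : F),
      f (x, y') ≤ f (x, y) + ⟪gy (x, y), y' - y⟫ + (β / 2) * ‖y' - y‖ ^ 2)
    (xs : E) (ys : F) (hmin : ∀ p : E × F, f (xs, ys) ≤ f p)
    (fs : ℝ) (hfs : fs = f (xs, ys))
    (hgxs : gx (xs, ys) = 0) (hgys : gy (xs, ys) = 0)
    (C : ℝ) (hC : 0 < C)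
    (hbistab : ∀ (x : E) (y : F) (xt : E) (yt : F),
      (∀ x' : E, f (xt, y) ≤ f (x', y)) → (∀ y' : F, f (x, yt) ≤ f (x, y')) →
      f (x, ys) + f (xs, y) - 2 * fs ≤ C * (2 * f (x, y) - f (x, yt) - f (xt, y)))
    (hgrad0x : ∀ (x : E) (y : F), (∀ x' : E, f (x, y) ≤ f (x', y)) → gx (x, y) = 0)
    (hgrad0y : ∀ (x : E) (y : F), (∀ y' : F, f (x, y) ≤ f (x, y')) → gy (x, y) = 0)
    (x : ℕ → E) (y : ℕ → F)
    (hxk : ∀ (k : ℕ) (x' : E), f (x (k + 1), y k) ≤ f (x', y k))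
    (hyk : ∀ (k : ℕ) (y' : F), f (x (k + 1), y (k + 1)) ≤ f (x (k + 1), y'))
    (κ η₀ : ℝ) (hκ : κ = β / α)
    (hη₀ : η₀ = 2 * κ * (1 + C * κ) / (1 + 2 * κ * (1 + C * κ))) :
    ∀ k : ℕ, f (x (k + 1), y (k + 1)) - fs ≤ η₀ * (f (x k, y k) - fs) := by
  intro k
  have hb := hbistab (x (k + 1)) (y k) (x (k + 1)) (y (k + 1)) (hxk k) (hyk k)
  have h1 := hyk k ys
  have h2 := hyk k (y k)
  have h3 := hxk k (x k)
  have h4 := hmin (xs, y k)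
  have hk : 1 ≤ κ := by rw [hκ, le_div_iff₀ hα]; linarith
  have hD : C ≤ 2 * κ * (1 + C * κ) := by
    have : 1 ≤ κ * κ := by nlinarith
    nlinarith
  generalize 2 * κ * (1 + C * κ) = D at hD hη₀
  have hpos : 0 < 1 + D := by linarith
  have key : f (x (k + 1), y (k + 1)) - fs
      ≤ C * (f (x (k + 1), y k) - f (x (k + 1), y (k + 1))) := by
    linarith
  have h5 : C * (f (x (k + 1), y k) - f (x (k + 1), y (k + 1)))
      ≤ D * (f (x k, y k) - f (x (k + 1), y (k + 1))) :=
    mul_le_mul hD (by linarith) (by linarith) (by linarith)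
  rw [hη₀, div_mul_eq_mul_div, le_div_iff₀ hpos]
  linarith
end

section
/- (Linear convergence of alternating minimization, Theorem 1.) Under the hypotheses of the per-step contraction — f : E × F → ℝ on real inner product spaces, α-marginally strongly convex and β-marginally strongly smooth with 0 < α ≤ β, global minimizer (x*, y*) with f* = f(x*, y*) and vanishing marginal gradients, C-robust bistability with C > 0, vanishing marginal gradients at all marginal minimizers, and alternating iterates x_{k+1} minimizing f(·, y_k), y_{k+1} minimizing f(x_{k+1}, ·) — set κ = β/α and η₀ = 2κ(1 + Cκ)/(1 + 2κ(1 + Cκ)). Then η₀ < 1 and, for every T : ℕ, f(x_T, y_T) - f* ≤ η₀^T · (f(x_0, y_0) - f*); in particular, for every ε > 0, f(x_T, y_T) ≤ f* + ε whenever η₀^T · (f(x_0, y_0) - f*) ≤ ε. -/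
open scoped RealInnerProductSpace

/-- Linear convergence of alternating minimization (Theorem 1): under α-marginal strong
convexity, β-marginal strong smoothness (`0 < α ≤ β`), a global minimizer `(x*, y*)`
with vanishing marginal gradients and value `f*`, C-robust bistability (`C > 0`),
vanishing marginal gradients at all marginal minimizers, and alternating iterates
`x_{k+1} ∈ argmin f(·, y_k)`, `y_{k+1} ∈ argmin f(x_{k+1}, ·)`, setting `κ = β/α` and
`η₀ = 2κ(1 + Cκ)/(1 + 2κ(1 + Cκ))`, one has `η₀ < 1` and
`f(x_T, y_T) - f* ≤ η₀^T (f(x_0, y_0) - f*)` for every `T`; in particular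
`f(x_T, y_T) ≤ f* + ε` whenever `η₀^T (f(x_0, y_0) - f*) ≤ ε`. -/
theorem alternating_minimization_linear_convergence
    {E F : Type*} [NormedAddCommGroup E] [InnerProductSpace ℝ E]
    [NormedAddCommGroup F] [InnerProductSpace ℝ F]
    (f : E × F → ℝ) (gx : E × F → E) (gy : E × F → F)
    (α β : ℝ) (hα : 0 < α) (hαβ : α ≤ β)
    (hMSCx : ∀ (x x' : E) (y : F),
      f (x', y) ≥ f (x, y) + ⟪gx (x, y), x' - x⟫ + (α / 2) * ‖x' - x‖ ^ 2)
    (hMSCy : ∀ (x : E) (y y' : F),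
      f (x, y') ≥ f (x, y) + ⟪gy (x, y), y' - y⟫ + (α / 2) * ‖y' - y‖ ^ 2)
    (hMSSx : ∀ (x x' : E) (y : F),
      f (x', y) ≤ f (x, y) + ⟪gx (x, y), x' - x⟫ + (β / 2) * ‖x' - x‖ ^ 2)
    (hMSSy : ∀ (x : E) (y y' : F),
      f (x, y') ≤ f (x, y) + ⟪gy (x, y), y' - y⟫ + (β / 2) * ‖y' - y‖ ^ 2)
    (xs : E) (ys : F) (hmin : ∀ p : E × F, f (xs, ys) ≤ f p)
    (fs : ℝ) (hfs : fs = f (xs, ys))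
    (hgxs : gx (xs, ys) = 0) (hgys : gy (xs, ys) = 0)
    (C : ℝ) (hC : 0 < C)
    (hbistab : ∀ (x : E) (y : F) (xt : E) (yt : F),
      (∀ x' : E, f (xt, y) ≤ f (x', y)) → (∀ y' : F, f (x, yt) ≤ f (x, y')) →
      f (x, ys) + f (xs, y) - 2 * fs ≤ C * (2 * f (x, y) - f (x, yt) - f (xt, y)))
    (hgrad0x : ∀ (x : E) (y : F), (∀ x' : E, f (x, y) ≤ f (x', y)) → gx (x, y) = 0)
    (hgrad0y : ∀ (x : E) (y : F), (∀ y' : F, f (x, y) ≤ f (x, y')) → gy (x, y) = 0)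
    (x : ℕ → E) (y : ℕ → F)
    (hxk : ∀ (k : ℕ) (x' : E), f (x (k + 1), y k) ≤ f (x', y k))
    (hyk : ∀ (k : ℕ) (y' : F), f (x (k + 1), y (k + 1)) ≤ f (x (k + 1), y'))
    (κ η₀ : ℝ) (hκ : κ = β / α)
    (hη₀ : η₀ = 2 * κ * (1 + C * κ) / (1 + 2 * κ * (1 + C * κ))) :
    η₀ < 1 ∧
    (∀ T : ℕ, f (x T, y T) - fs ≤ η₀ ^ T * (f (x 0, y 0) - fs)) ∧
    (∀ ε : ℝ, 0 < ε → ∀ T : ℕ,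
      η₀ ^ T * (f (x 0, y 0) - fs) ≤ ε → f (x T, y T) ≤ fs + ε) := by
  have hκ1 : 1 ≤ κ := by rw [hκ, le_div_iff₀ hα]; linarith
  obtain ⟨A, hA⟩ : ∃ A, A = 2 * κ * (1 + C * κ) := ⟨_, rfl⟩
  rw [← hA] at hη₀
  have hCκ : C ≤ C * κ := by nlinarith
  have hAC : C ≤ A := by
    rw [hA]; nlinarith [mul_pos hC (by linarith : (0 : ℝ) < κ)]
  have hA0 : 0 < A := by linarith
  have hη1 : η₀ < 1 := by rw [hη₀, div_lt_one (by linarith)]; linarith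
  have hηnn : 0 ≤ η₀ := by rw [hη₀]; positivity
  -- bistability at `(x (k+1), y k)` controls the decrease of the `y`-step
  have step : ∀ k, f (x (k + 1), y (k + 1)) - fs ≤ η₀ * (f (x k, y k) - fs) := by
    intro k
    have h1 := hbistab (x (k + 1)) (y k) (x (k + 1)) (y (k + 1)) (hxk k) (hyk k)
    have h2 := hyk k ys
    have h3 := hmin (xs, y k)
    have h4 := hxk k (x k)
    have h5 := hyk k (y k)
    have h6 : C * (f (x (k + 1), y k) - f (x (k + 1), y (k + 1))) ≤
        A * (f (x k, y k) - f (x (k + 1), y (k + 1))) :=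
      mul_le_mul hAC (by linarith) (by linarith) hA0.le
    rw [hη₀, div_mul_eq_mul_div, le_div_iff₀ (by linarith)]
    linarith
  have main : ∀ T : ℕ, f (x T, y T) - fs ≤ η₀ ^ T * (f (x 0, y 0) - fs) := by
    intro T
    induction T with
    | zero => simp
    | succ k ih =>
      calc _ ≤ η₀ * (f (x k, y k) - fs) := step k
        _ ≤ η₀ * (η₀ ^ k * (f (x 0, y 0) - fs)) := mul_le_mul_of_nonneg_left ih hηnn
        _ = _ := by ring
  exact ⟨hη1, main, fun ε _ T h => by linarith [main T]⟩
end
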